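/- Let ψ1(α) = 2Λ(α/2) − Λ(α) where Λ(x) = max{1−|x|, 0} is the triangle function, and let v(α1,α2) = ∫_0^N e(α2 t² + α1 t) dt. Define ψ(α1,α2) = ψ_{Q/N}(α1)·ψ_{Q²/N²}(α2) with ψ_P(α) = 2Λ(α/(2P)) − Λ(α/P). Then for every (m1, m2) ∈ ℕ², the Fourier coefficient ∫_{[−1/2,1/2]²} ψ(α) v(α)³ e(−(α1 m1 + α2 m2)) dα is bounded by an absolute constant, uniformly in N, Q, m1, m2 (with 64 Q^52 ≤ N). -/

import Mathlib

open Finset Complex MeasureTheory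

noncomputable def triFn (x : ℝ) : ℝ := max (1 - |x|) 0

noncomputable def psiP (P : ℝ) (α : ℝ) : ℝ := 2 * triFn (α / (2 * P)) - triFn (α / P)

lemma scale_le (c : ℝ) (hc : 1 ≤ c) (f : ℝ → ENNReal) (hf : Measurable f) :
    ∫⁻ x, f (c * x) ≤ ∫⁻ x, f x := by
  have h0 : c ≠ 0 := by positivity
  have h := lintegral_map (μ := (volume : Measure ℝ)) hf (measurable_const_mul c)
  rw [← h, Real.map_volume_mul_left h0, lintegral_smul_measure, smul_eq_mul]
  have h1 : ENNReal.ofReal |c⁻¹| ≤ 1 := by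
    rw [ENNReal.ofReal_le_one, abs_of_nonneg (by positivity)]
    exact inv_le_one_of_one_le₀ hc
  calc _ ≤ 1 * ∫⁻ x, f x := by gcongr
    _ = _ := one_mul _

lemma sq_subst (H : ℝ → ENNReal) :
    ∫⁻ r in Set.Ioi (0:ℝ), ENNReal.ofReal r * H (r ^ 2) ≤ ∫⁻ u, H u := by
  have h := lintegral_image_eq_lintegral_abs_deriv_mul (s := Set.Ioi (0:ℝ)) (f := fun x => x ^ 2)
    (f' := fun x => 2 * x) measurableSet_Ioi
    (fun x _ => by simpa using (hasDerivAt_pow 2 x).hasDerivWithinAt)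
    (fun x hx y hy hxy => by
      have hx' : 0 < x := hx
      have hy' : 0 < y := hy
      exact (pow_left_inj₀ hx'.le hy'.le two_ne_zero).1 hxy) H
  calc _ ≤ ∫⁻ x in Set.Ioi (0:ℝ), ENNReal.ofReal |2 * x| * H (x ^ 2) := by
        refine setLIntegral_mono' measurableSet_Ioi fun x hx => ?_
        have hx' : 0 < x := hx
        gcongr
        rw [abs_of_pos (by positivity)]
        linarith
    _ ≤ _ := by rw [← h]; exact setLIntegral_le_lintegral _ _

lemma polar_le (H : ℝ → ENNReal) (hH : Measurable H) :
    ∫⁻ p : ℝ × ℝ, H (p.1 ^ 2 + p.2 ^ 2) ≤ ENNReal.ofReal (2 * Real.pi) * ∫⁻ u, H u := by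
  rw [← lintegral_comp_polarCoord_symm]
  have e1 : ∀ p : ℝ × ℝ, (polarCoord.symm p).1 ^ 2 + (polarCoord.symm p).2 ^ 2 = p.1 ^ 2 := by
    intro p
    simp only [polarCoord_symm_apply]
    linear_combination p.1 ^ 2 * (Real.sin_sq_add_cos_sq p.2)
  simp only [e1, smul_eq_mul, polarCoord_target]
  rw [Measure.volume_eq_prod, ← Measure.prod_restrict, lintegral_prod _ (by fun_prop)]
  simp only [lintegral_const, Measure.restrict_apply MeasurableSet.univ, Set.univ_inter,
    Real.volume_Ioo]
  rw [lintegral_mul_const _ (by fun_prop), mul_comm]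
  exact mul_le_mul' (ENNReal.ofReal_le_ofReal (by linarith)) (sq_subst H)

lemma quad_le (G : ℝ → ENNReal) (hG : Measurable G) (s : ℝ) :
    ∫⁻ a : ℝ, ∫⁻ b : ℝ, G (a ^ 2 + b ^ 2 + (s - a - b) ^ 2) ≤
      ENNReal.ofReal (2 * Real.pi) * ∫⁻ u, G u := by
  have h1 : ∀ a : ℝ, ∫⁻ b : ℝ, G (a ^ 2 + b ^ 2 + (s - a - b) ^ 2) ≤
      ∫⁻ b : ℝ, G (3 / 2 * (a - s / 3) ^ 2 + s ^ 2 / 3 + b ^ 2) := by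
    intro a
    rw [← lintegral_add_left_eq_self _ ((s - a) / 2)]
    refine le_trans (le_of_eq ?_) (scale_le (√2) ?_ _ (by fun_prop))
    · refine lintegral_congr fun b => ?_
      congr 1
      rw [mul_pow, Real.sq_sqrt (by norm_num)]
      ring
    · rw [Real.one_le_sqrt]; norm_num
  refine (lintegral_mono h1).trans ?_
  rw [← lintegral_add_left_eq_self _ (s / 3)]
  have hm : Measurable fun p : ℝ × ℝ => G (p.1 ^ 2 + s ^ 2 / 3 + p.2 ^ 2) := by fun_prop
  have hm2 : Measurable fun a : ℝ => ∫⁻ b : ℝ, G (a ^ 2 + s ^ 2 / 3 + b ^ 2) :=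
    hm.lintegral_prod_right'
  have h2 : ∫⁻ a : ℝ, ∫⁻ b : ℝ, G (3 / 2 * (s / 3 + a - s / 3) ^ 2 + s ^ 2 / 3 + b ^ 2) ≤
      ∫⁻ a : ℝ, ∫⁻ b : ℝ, G (a ^ 2 + s ^ 2 / 3 + b ^ 2) := by
    refine le_trans (le_of_eq ?_) (scale_le (√(3/2)) ?_ _ hm2)
    · refine lintegral_congr fun a => lintegral_congr fun b => ?_
      congr 1
      rw [mul_pow, Real.sq_sqrt (by norm_num)]
      ring
    · rw [Real.one_le_sqrt]; norm_num
  refine h2.trans ?_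
  rw [← lintegral_prod _ hm.aemeasurable, ← Measure.volume_eq_prod]
  have h3 := polar_le (fun u => G (s ^ 2 / 3 + u)) (by fun_prop)
  rw [lintegral_add_left_eq_self] at h3
  refine le_trans (le_of_eq ?_) h3
  refine lintegral_congr fun a => ?_
  congr 1
  ring

lemma geom_bound (F G : ℝ → ENNReal) (hF : Measurable F) (hG : Measurable G) :
    ∫⁻ z : ℝ × ℝ × ℝ, F (z.1 + z.2.1 + z.2.2) * G (z.1 ^ 2 + z.2.1 ^ 2 + z.2.2 ^ 2) ≤
      (∫⁻ u, F u) * (ENNReal.ofReal (2 * Real.pi) * ∫⁻ u, G u) := by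
  rw [Measure.volume_eq_prod, lintegral_prod _ (by fun_prop)]
  have h1 : ∀ a : ℝ, ∫⁻ y : ℝ × ℝ, F (a + y.1 + y.2) * G (a ^ 2 + y.1 ^ 2 + y.2 ^ 2) =
      ∫⁻ s : ℝ, F s * ∫⁻ b : ℝ, G (a ^ 2 + b ^ 2 + (s - a - b) ^ 2) := by
    intro a
    rw [Measure.volume_eq_prod, lintegral_prod _ (by fun_prop)]
    have : ∀ b : ℝ, ∫⁻ c : ℝ, F (a + b + c) * G (a ^ 2 + b ^ 2 + c ^ 2) =
        ∫⁻ s : ℝ, F s * G (a ^ 2 + b ^ 2 + (s - a - b) ^ 2) := by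
      intro b
      rw [← lintegral_add_left_eq_self (fun s => F s * G (a ^ 2 + b ^ 2 + (s - a - b) ^ 2)) (a + b)]
      refine lintegral_congr fun c => ?_
      congr 3
      ring
    simp only [this]
    rw [lintegral_lintegral_swap (by fun_prop)]
    refine lintegral_congr fun c => ?_
    rw [lintegral_const_mul _ (by fun_prop)]
  simp only [h1]
  have hm : Measurable fun q : (ℝ × ℝ) × ℝ =>
      G (q.1.1 ^ 2 + q.2 ^ 2 + (q.1.2 - q.1.1 - q.2) ^ 2) := by fun_prop
  have hm' : Measurable fun q : ℝ × ℝ => ∫⁻ b : ℝ, G (q.1 ^ 2 + b ^ 2 + (q.2 - q.1 - b) ^ 2) :=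
    hm.lintegral_prod_right'
  rw [lintegral_lintegral_swap]
  · rw [← lintegral_mul_const _ hF]
    refine lintegral_mono fun s => ?_
    rw [lintegral_const_mul _ (by exact hm'.comp (measurable_id.prodMk measurable_const))]
    gcongr
    exact quad_le G hG s
  · exact ((hF.comp measurable_snd).mul hm').aemeasurable

lemma triFn_cont : Continuous triFn := by unfold triFn; fun_prop

lemma triFn_nonneg (x : ℝ) : 0 ≤ triFn x := le_max_right _ _

lemma triFn_le_one (x : ℝ) : triFn x ≤ 1 := by
  unfold triFn
  exact max_le (by linarith [abs_nonneg x]) zero_le_one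

noncomputable def triK (P u : ℝ) : ℂ :=
  ∫ a in Set.Icc (-(1:ℝ)/2) ((1:ℝ)/2), (triFn (a / P) : ℂ) * cexp (2 * Real.pi * I * (a * u))

lemma triInt_cont (P u : ℝ) :
    Continuous fun a : ℝ => (triFn (a / P) : ℂ) * cexp (2 * Real.pi * I * (a * u)) := by
  have := triFn_cont
  fun_prop

lemma norm_e (x : ℂ) (y : ℝ) (h : x = y) : ‖cexp (2 * Real.pi * I * x)‖ = 1 := by
  rw [h, Complex.norm_exp]
  simp

lemma triK_split (P u : ℝ) (hP : 0 < P) (hP2 : P ≤ 1 / 2) :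
    triK P u = (∫ a in (-P)..0, (triFn (a / P) : ℂ) * cexp (2 * Real.pi * I * (a * u))) +
      ∫ a in (0:ℝ)..P, (triFn (a / P) : ℂ) * cexp (2 * Real.pi * I * (a * u)) := by
  rw [intervalIntegral.integral_add_adjacent_intervals
    ((triInt_cont P u).intervalIntegrable _ _) ((triInt_cont P u).intervalIntegrable _ _),
    intervalIntegral.integral_of_le (by linarith), ← integral_Icc_eq_integral_Ioc, triK]
  refine (setIntegral_eq_of_subset_of_forall_sdiff_eq_zero measurableSet_Icc
    (Set.Icc_subset_Icc (by linarith) hP2) ?_)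
  intro x hx
  have : triFn (x / P) = 0 := by
    unfold triFn
    refine max_eq_right ?_
    rw [sub_nonpos, abs_div, abs_of_pos hP, one_le_div hP]
    by_contra! h
    exact hx.2 (abs_le.1 h.le)
  simp [this]

lemma triK_le1 (P u : ℝ) (hP : 0 < P) (hP2 : P ≤ 1 / 2) : ‖triK P u‖ ≤ 2 * P := by
  rw [triK_split P u hP hP2]
  have hb : ∀ a : ℝ, ‖(triFn (a / P) : ℂ) * cexp (2 * Real.pi * I * (a * u))‖ ≤ 1 := by
    intro a
    rw [norm_mul, norm_e _ (a * u) (by push_cast; rfl), mul_one, Complex.norm_real,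
      Real.norm_of_nonneg (triFn_nonneg _)]
    exact triFn_le_one _
  have h1 := intervalIntegral.norm_integral_le_of_norm_le_const (a := -P) (b := 0)
    (fun a _ => hb a)
  have h2 := intervalIntegral.norm_integral_le_of_norm_le_const (a := 0) (b := P)
    (fun a _ => hb a)
  rw [one_mul, abs_of_pos (by linarith)] at h1 h2
  refine (norm_add_le _ _).trans ?_
  linarith

lemma triK_eq (P u : ℝ) (hP : 0 < P) (hP2 : P ≤ 1 / 2) (hu : u ≠ 0) :
    triK P u = (cexp (2 * Real.pi * I * u * P) + cexp (-(2 * Real.pi * I * u * P)) - 2) /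
      (P * (2 * Real.pi * I * u) ^ 2) := by
  rw [triK_split P u hP hP2]
  set c : ℂ := 2 * Real.pi * I * u with hc
  have hc0 : c ≠ 0 := by
    rw [hc]
    have : (Real.pi : ℂ) ≠ 0 := by exact_mod_cast Real.pi_ne_zero
    have : (u : ℂ) ≠ 0 := by exact_mod_cast hu
    simp [*]
  have hPc : (P : ℂ) ≠ 0 := by exact_mod_cast hP.ne'
  have hexp : ∀ a : ℝ, HasDerivAt (fun a : ℝ => cexp (c * a)) (c * cexp (c * a)) a := by
    intro a
    have h := ((Complex.ofRealCLM.hasDerivAt (x := a)).const_mul c).cexp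
    simpa [mul_comm] using h
  have hid : ∀ a : ℝ, HasDerivAt (fun a : ℝ => (a : ℂ)) 1 a := fun a => by
    simpa using (hasDerivAt_id a).ofReal_comp
  have h1 : (∫ a in (-P)..0, (triFn (a / P) : ℂ) * cexp (2 * Real.pi * I * (a * u))) =
      (1 / c - 1 / (P * c ^ 2)) - (- cexp (-(c * P)) / (P * c ^ 2)) := by
    have := intervalIntegral.integral_eq_sub_of_hasDerivAt (a := -P) (b := 0)
      (f := fun a : ℝ => (1 + (a : ℂ) / P) * cexp (c * a) / c - cexp (c * a) / (P * c ^ 2))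
      (f' := fun a : ℝ => (1 + (a : ℂ) / P) * cexp (c * a)) (fun a _ => by
        have h := (((((hid a).div_const (P:ℂ)).const_add 1).mul (hexp a)).div_const c).sub
          ((hexp a).div_const (P * c ^ 2))
        refine h.congr_deriv ?_
        field_simp
        ring) (Continuous.intervalIntegrable (by fun_prop) _ _)
    have h2 : (∫ a in (-P)..0, (triFn (a / P) : ℂ) * cexp (2 * Real.pi * I * (a * u))) =
        ∫ a in (-P)..0, (1 + (a : ℂ) / P) * cexp (c * a) := by
      refine intervalIntegral.integral_congr fun a ha => ?_
      rw [Set.uIcc_of_le (by linarith)] at ha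
      have : triFn (a / P) = 1 + a / P := by
        unfold triFn
        rw [abs_of_nonpos (div_nonpos_of_nonpos_of_nonneg ha.2 hP.le), max_eq_left]
        · ring
        · have : -1 ≤ a / P := by rw [le_div_iff₀ hP]; linarith [ha.1]
          linarith
      simp only [this]
      push_cast
      congr 2
      rw [hc]; ring
    rw [h2, this]
    push_cast
    rw [neg_div, div_self hPc]
    simp
    try ring
  have h2 : (∫ a in (0:ℝ)..P, (triFn (a / P) : ℂ) * cexp (2 * Real.pi * I * (a * u))) =
      (cexp (c * P) / (P * c ^ 2)) - (1 / c + 1 / (P * c ^ 2)) := by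
    have := intervalIntegral.integral_eq_sub_of_hasDerivAt (a := 0) (b := P)
      (f := fun a : ℝ => (1 - (a : ℂ) / P) * cexp (c * a) / c + cexp (c * a) / (P * c ^ 2))
      (f' := fun a : ℝ => (1 - (a : ℂ) / P) * cexp (c * a)) (fun a _ => by
        have h := (((((hid a).div_const (P:ℂ)).const_sub 1).mul (hexp a)).div_const c).add
          ((hexp a).div_const (P * c ^ 2))
        refine h.congr_deriv ?_
        field_simp
        ring) (Continuous.intervalIntegrable (by fun_prop) _ _)
    have h2 : (∫ a in (0:ℝ)..P, (triFn (a / P) : ℂ) * cexp (2 * Real.pi * I * (a * u))) =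
        ∫ a in (0:ℝ)..P, (1 - (a : ℂ) / P) * cexp (c * a) := by
      refine intervalIntegral.integral_congr fun a ha => ?_
      rw [Set.uIcc_of_le (by linarith)] at ha
      have : triFn (a / P) = 1 - a / P := by
        unfold triFn
        rw [abs_of_nonneg (div_nonneg ha.1 hP.le), max_eq_left]
        have : a / P ≤ 1 := by rw [div_le_iff₀ hP]; linarith [ha.2]
        linarith
      simp only [this]
      push_cast
      congr 2
      rw [hc]; ring
    rw [h2, this]
    push_cast
    rw [div_self hPc]
    simp
    try ring
  rw [h1, h2]
  field_simp
  ring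

lemma triK_le (P u : ℝ) (hP : 0 < P) (hP2 : P ≤ 1 / 2) :
    ‖triK P u‖ ≤ 3 * P / (1 + (P * u) ^ 2) := by
  rw [le_div_iff₀ (by positivity)]
  have h1 := triK_le1 P u hP hP2
  have h2 : ‖triK P u‖ * (P * u) ^ 2 ≤ P := by
    by_cases hu : u = 0
    · simp [hu, hP.le]
    rw [triK_eq P u hP hP2 hu, norm_div]
    have e1 : ‖(P * (2 * Real.pi * I * u) ^ 2 : ℂ)‖ = P * (4 * Real.pi ^ 2 * u ^ 2) := by
      simp only [norm_mul, norm_pow, Complex.norm_real, Complex.norm_I, Real.norm_eq_abs,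
        abs_of_pos hP, abs_of_pos Real.pi_pos, mul_pow, sq_abs, Complex.norm_ofNat]
      ring
    have e2 : ‖cexp (2 * Real.pi * I * u * P) + cexp (-(2 * Real.pi * I * u * P)) - 2‖ ≤ 4 := by
      refine (norm_sub_le _ _).trans ?_
      have a1 := norm_e (u * P) (u * P) (by push_cast; rfl)
      have a2 := norm_e (-(u * P)) (-(u * P)) (by push_cast; rfl)
      have b1 : 2 * Real.pi * I * u * P = 2 * Real.pi * I * (u * P) := by ring
      have b2 : -(2 * Real.pi * I * u * P) = 2 * Real.pi * I * (-(u * P)) := by ring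
      have := norm_add_le (cexp (2 * Real.pi * I * u * P)) (cexp (-(2 * Real.pi * I * u * P)))
      rw [b2, b1, a1, a2] at this
      rw [b2, b1]
      norm_num at this ⊢
      linarith
    rw [e1, div_mul_eq_mul_div, div_le_iff₀ (by positivity)]
    have hu2 : 0 < u ^ 2 := by positivity
    have hpi : 1 ≤ Real.pi ^ 2 := by nlinarith [Real.pi_gt_three]
    calc _ ≤ 4 * (P * u) ^ 2 := by gcongr
      _ = P * (P * (4 * 1 * u ^ 2)) := by ring
      _ ≤ _ := by gcongr
  nlinarith

noncomputable def psiK (P u : ℝ) : ℂ :=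
  ∫ a in Set.Icc (-(1:ℝ)/2) ((1:ℝ)/2), (psiP P a : ℂ) * cexp (2 * Real.pi * I * (a * u))

lemma psiK_le (P u : ℝ) (hP : 0 < P) (hP2 : P ≤ 1 / 4) :
    ‖psiK P u‖ ≤ 15 * P * (1 + (P * u) ^ 2)⁻¹ := by
  have h : psiK P u = 2 * triK (2 * P) u - triK P u := by
    unfold psiK triK
    rw [← integral_const_mul, ← integral_sub]
    · congr 1
      ext a
      unfold psiP
      push_cast
      ring
    · exact ((triInt_cont (2 * P) u).continuousOn.integrableOn_compact isCompact_Icc).const_mul 2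
    · exact (triInt_cont P u).continuousOn.integrableOn_compact isCompact_Icc
  rw [h]
  have h1 := triK_le P u hP (by linarith)
  have h2 := triK_le (2 * P) u (by linarith) (by linarith)
  have h3 : 3 * (2 * P) / (1 + (2 * P * u) ^ 2) ≤ 6 * P / (1 + (P * u) ^ 2) := by
    gcongr ?_ / (1 + ?_)
    · linarith
    · nlinarith [sq_nonneg (P * u)]
  calc _ ≤ ‖2 * triK (2 * P) u‖ + ‖triK P u‖ := norm_sub_le _ _
    _ ≤ 2 * (6 * P / (1 + (P * u) ^ 2)) + 3 * P / (1 + (P * u) ^ 2) := by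
      rw [norm_mul]
      norm_num
      linarith
    _ = _ := by field_simp; ring

lemma ker_int (P m : ℝ) (hP : 0 < P) :
    ∫⁻ u, ENNReal.ofReal (15 * P * (1 + (P * (u - m)) ^ 2)⁻¹) = ENNReal.ofReal (15 * Real.pi) := by
  have hi : Integrable fun u : ℝ => (1 + (P * (u - m)) ^ 2)⁻¹ :=
    (integrable_inv_one_add_sq.comp_mul_left' hP.ne').comp_sub_right m
  rw [← ofReal_integral_eq_lintegral_ofReal (hi.const_mul _)
    (Filter.Eventually.of_forall fun u => by positivity)]
  congr 1
  rw [integral_const_mul, integral_sub_right_eq_self (fun u => (1 + (P * u) ^ 2)⁻¹) m,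
    Measure.integral_comp_mul_left (fun u => (1 + u ^ 2)⁻¹) P, integral_univ_inv_one_add_sq,
    abs_of_pos (by positivity), smul_eq_mul]
  field_simp

lemma psiP_cont (P : ℝ) : Continuous (psiP P) := by
  have := triFn_cont
  unfold psiP
  fun_prop

lemma psiP_abs (P x : ℝ) : ‖(psiP P x : ℂ)‖ ≤ 2 := by
  rw [Complex.norm_real, Real.norm_eq_abs]
  unfold psiP
  have h1 := triFn_nonneg (x / (2 * P))
  have h2 := triFn_nonneg (x / P)
  have h3 := triFn_le_one (x / (2 * P))
  have h4 := triFn_le_one (x / P)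
  rw [abs_le]
  constructor <;> linarith

lemma cube_eq (N : ℝ) (hN : 0 ≤ N) (x y : ℝ) :
    (∫ t in (0:ℝ)..N, cexp (2 * Real.pi * I * (y * t ^ 2 + x * t))) ^ 3 =
    ∫ z : ℝ × ℝ × ℝ, cexp (2 * Real.pi * I * (x * (z.1 + z.2.1 + z.2.2 : ℝ))) *
        cexp (2 * Real.pi * I * (y * (z.1 ^ 2 + z.2.1 ^ 2 + z.2.2 ^ 2 : ℝ)))
      ∂((volume.restrict (Set.Ioc 0 N)).prod
        ((volume.restrict (Set.Ioc 0 N)).prod (volume.restrict (Set.Ioc 0 N)))) := by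
  rw [intervalIntegral.integral_of_le hN, pow_succ', pow_two, ← integral_prod_mul,
    ← integral_prod_mul]
  refine integral_congr_ae (Filter.Eventually.of_forall fun z => ?_)
  simp only [← Complex.exp_add]
  congr 1
  push_cast
  ring

lemma main_bound (N P₁ P₂ m₁ m₂ : ℝ) (hN : 0 ≤ N) (h₁ : 0 < P₁) (h₁' : P₁ ≤ 1 / 4)
    (h₂ : 0 < P₂) (h₂' : P₂ ≤ 1 / 4) :
    ‖∫ α in Set.Icc ((-(1:ℝ)/2), (-(1:ℝ)/2)) ((1:ℝ)/2, (1:ℝ)/2),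
        (psiP P₁ α.1 * psiP P₂ α.2 : ℂ) *
          (∫ t in (0:ℝ)..N, cexp (2 * Real.pi * I * (α.2 * t ^ 2 + α.1 * t))) ^ 3 *
          cexp (-(2 * Real.pi * I) * (α.1 * m₁ + α.2 * m₂))‖ ≤
      15 * Real.pi * (2 * Real.pi * (15 * Real.pi)) := by
  set μ : Measure (ℝ × ℝ × ℝ) := (volume.restrict (Set.Ioc 0 N)).prod
        ((volume.restrict (Set.Ioc 0 N)).prod (volume.restrict (Set.Ioc 0 N))) with hμ
  set ν : Measure ℝ := volume.restrict (Set.Icc (-(1:ℝ)/2) ((1:ℝ)/2)) with hν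
  have hset : (volume : Measure (ℝ × ℝ)).restrict
      (Set.Icc ((-(1:ℝ)/2), (-(1:ℝ)/2)) ((1:ℝ)/2, (1:ℝ)/2)) = ν.prod ν := by
    rw [hν, Measure.prod_restrict, ← Measure.volume_eq_prod, Set.Icc_prod_eq]
  rw [hset]
  let f : ℝ × ℝ → ℝ × ℝ × ℝ → ℂ := fun α z =>
    (psiP P₁ α.1 * cexp (2 * Real.pi * I * (α.1 * ((z.1 + z.2.1 + z.2.2 - m₁ : ℝ) : ℂ)))) *
    (psiP P₂ α.2 * cexp (2 * Real.pi * I * (α.2 * ((z.1 ^ 2 + z.2.1 ^ 2 + z.2.2 ^ 2 - m₂ : ℝ) : ℂ))))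
  have hstep : (∫ α, (psiP P₁ α.1 * psiP P₂ α.2 : ℂ) *
          (∫ t in (0:ℝ)..N, cexp (2 * Real.pi * I * (α.2 * t ^ 2 + α.1 * t))) ^ 3 *
          cexp (-(2 * Real.pi * I) * (α.1 * m₁ + α.2 * m₂)) ∂(ν.prod ν)) =
      ∫ α, ∫ z, f α z ∂μ ∂(ν.prod ν) := by
    refine integral_congr_ae (Filter.Eventually.of_forall fun α => ?_)
    simp only
    rw [cube_eq N hN, ← hμ, ← integral_const_mul, ← integral_mul_const]
    refine integral_congr_ae (Filter.Eventually.of_forall fun z => ?_)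
    simp only [f]
    have e : ∀ a b c d e' p q : ℂ, cexp a * cexp b * cexp c = cexp d * cexp e' →
        p * q * (cexp a * cexp b) * cexp c = p * cexp d * (q * cexp e') := by
      intro a b c d e' p q h
      linear_combination p * q * h
    apply e
    simp only [← Complex.exp_add]
    congr 1
    push_cast
    ring
  have hcont : Continuous (Function.uncurry f) := by
    have c1 := psiP_cont P₁
    have c2 := psiP_cont P₂
    simp only [f, Function.uncurry_def]
    fun_prop
  have hint : Integrable (Function.uncurry f) ((ν.prod ν).prod μ) := by
    refine Integrable.of_bound hcont.aestronglyMeasurable (2 * 2)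
      (Filter.Eventually.of_forall fun p => ?_)
    simp only [f, Function.uncurry_def]
    rw [norm_mul, norm_mul, norm_mul,
      norm_e _ (p.1.1 * (p.2.1 + p.2.2.1 + p.2.2.2 - m₁)) (by push_cast; rfl),
      norm_e _ (p.1.2 * (p.2.1 ^ 2 + p.2.2.1 ^ 2 + p.2.2.2 ^ 2 - m₂)) (by push_cast; rfl),
      mul_one, mul_one]
    exact mul_le_mul (psiP_abs _ _) (psiP_abs _ _) (norm_nonneg _) (by norm_num)
  rw [hstep, integral_integral_swap hint]
  have hin : ∀ z : ℝ × ℝ × ℝ, ∫ α, f α z ∂(ν.prod ν) =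
      psiK P₁ (z.1 + z.2.1 + z.2.2 - m₁) *
        psiK P₂ (z.1 ^ 2 + z.2.1 ^ 2 + z.2.2 ^ 2 - m₂) := by
    intro z
    unfold psiK
    rw [← integral_prod_mul]
  simp only [hin]
  have hpi := Real.pi_pos
  rw [← ENNReal.ofReal_le_ofReal_iff (by positivity), ofReal_norm_eq_enorm]
  refine (enorm_integral_le_lintegral_enorm _).trans ?_
  have hμle : μ ≤ volume := by
    rw [hμ, Measure.prod_restrict, Measure.prod_restrict, ← Measure.volume_eq_prod,
      ← Measure.volume_eq_prod]
    exact Measure.restrict_le_self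
  refine (lintegral_mono' hμle le_rfl).trans ?_
  set F : ℝ → ENNReal := fun u => ENNReal.ofReal (15 * P₁ * (1 + (P₁ * (u - m₁)) ^ 2)⁻¹)
    with hF
  set G : ℝ → ENNReal := fun u => ENNReal.ofReal (15 * P₂ * (1 + (P₂ * (u - m₂)) ^ 2)⁻¹)
    with hG
  have hFm : Measurable F := by rw [hF]; fun_prop
  have hGm : Measurable G := by rw [hG]; fun_prop
  have hgeo := geom_bound F G hFm hGm
  rw [hF, ker_int P₁ m₁ h₁, hG, ker_int P₂ m₂ h₂, ← ENNReal.ofReal_mul (by positivity),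
    ← ENNReal.ofReal_mul (by positivity)] at hgeo
  refine le_trans (lintegral_mono fun z => ?_) hgeo
  rw [enorm_mul, ← ofReal_norm_eq_enorm, ← ofReal_norm_eq_enorm]
  exact mul_le_mul' (ENNReal.ofReal_le_ofReal (psiK_le _ _ h₁ h₁'))
    (ENNReal.ofReal_le_ofReal (psiK_le _ _ h₂ h₂'))

theorem stmt_16 :
    ∃ C : ℝ, 0 < C ∧ ∀ (N Q : ℕ), 0 < Q → 64 * Q ^ 52 ≤ N → ∀ m1 m2 : ℕ,
      ‖∫ α in Set.Icc ((-(1:ℝ)/2), (-(1:ℝ)/2)) ((1:ℝ)/2, (1:ℝ)/2),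
        (psiP ((Q:ℝ)/N) α.1 * psiP ((Q:ℝ)^2/(N:ℝ)^2) α.2 : ℂ) *
          (∫ t in (0:ℝ)..(N:ℝ),
            Complex.exp (2 * Real.pi * Complex.I * (α.2 * t ^ 2 + α.1 * t))) ^ 3 *
          Complex.exp (-(2 * Real.pi * Complex.I) * (α.1 * m1 + α.2 * m2))‖ ≤ C := by
  refine ⟨15 * Real.pi * (2 * Real.pi * (15 * Real.pi)), by positivity, ?_⟩
  intro N Q hQ hN m1 m2
  have h4 : 4 * Q ≤ N := by
    have : Q ≤ Q ^ 52 := Nat.le_self_pow (by norm_num) Q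
    omega
  have hN0 : 0 < N := by omega
  have hNr : (0:ℝ) < N := by exact_mod_cast hN0
  have hQr : (0:ℝ) < Q := by exact_mod_cast hQ
  have h4r : (4:ℝ) * Q ≤ N := by exact_mod_cast h4
  have hd : (Q:ℝ) / N ≤ 1 / 4 := by
    rw [div_le_iff₀ hNr]; linarith
  have hd0 : 0 < (Q:ℝ) / N := by positivity
  have hd2 : (Q:ℝ) ^ 2 / (N:ℝ) ^ 2 ≤ 1 / 4 := by
    rw [← div_pow]; nlinarith
  exact main_bound N (Q / N) ((Q:ℝ) ^ 2 / (N:ℝ) ^ 2) m1 m2 hNr.le hd0 hd (by positivity) hd2
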